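/- Let f ∈ S(ℝ^d₊) and set a_n = ∫_{ℝ^d₊} f(t) 𝓛_n(t) dt for n ∈ ℕ₀^d. Then ℱ_D(f) is holomorphic on the open unit polydisc D, the multiple power series ∑_{n∈ℕ₀^d} a_n w^n converges absolutely for every w ∈ D, and ℱ_D(f)(w) = ∏_{j=1}^d (1−w_j) · ∑_{n∈ℕ₀^d} a_n w^n for all w ∈ D. In particular, if ℱ_D(f)(w) = 0 for all w ∈ D, then f = 0. -/

import Mathlib

open MeasureTheory Filter Finset

noncomputable section

def Rpos (d : ℕ) : Set (Fin d → ℝ) := {x | ∀ i, 0 < x i}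

def pd {d : ℕ} (i : Fin d) (f : (Fin d → ℝ) → ℂ) : (Fin d → ℝ) → ℂ :=
  fun x => fderiv ℝ f x (Pi.single i 1)

def mderiv {d : ℕ} (p : Fin d → ℕ) (f : (Fin d → ℝ) → ℂ) : (Fin d → ℝ) → ℂ :=
  ((List.ofFn fun i : Fin d => (fun g => (pd i)^[p i] g)).foldr (· ∘ ·) id) f

/-- The space `S(ℝ^d₊)`. -/
def IsSPlus {d : ℕ} (f : (Fin d → ℝ) → ℂ) : Prop :=
  ContDiffOn ℝ (⊤ : ℕ∞) f (Rpos d) ∧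
  (∀ p : Fin d → ℕ, ∃ g : (Fin d → ℝ) → ℂ,
    ContinuousOn g {x | ∀ i, 0 ≤ x i} ∧ ∀ x ∈ Rpos d, g x = mderiv p f x) ∧
  (∀ k p : Fin d → ℕ, ∃ C : ℝ, ∀ x ∈ Rpos d,
    (∏ i, x i ^ k i) * ‖mderiv p f x‖ ≤ C)

/-- Laguerre polynomial of order `0`. -/
def lag0 (j : ℕ) (t : ℝ) : ℝ :=
  ∑ k ∈ Finset.range (j+1),
    (j.factorial : ℝ) / ((j-k).factorial * ((k.factorial : ℝ))^2) * (-t)^k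

/-- Laguerre function of order `0`. -/
def lagFun0 (j : ℕ) (t : ℝ) : ℝ := lag0 j t * Real.exp (-t/2)

def LagFun0 {d : ℕ} (n : Fin d → ℕ) (t : Fin d → ℝ) : ℝ := ∏ l, lagFun0 (n l) (t l)

/-- The open unit polydisc. -/
def Dpoly (d : ℕ) : Set (Fin d → ℂ) := {w | ∀ l, ‖w l‖ < 1}

/-- The transform `ℱ_D(f)(w) = ∫_{ℝ^d₊} f(t) ∏ e^{−(1/2)((1+w_l)/(1−w_l)) t_l} dt`. -/
def FD {d : ℕ} (f : (Fin d → ℝ) → ℂ) : (Fin d → ℂ) → ℂ :=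
  fun w => ∫ t in Rpos d, f t * ∏ l, Complex.exp (-(1/2) * ((1 + w l)/(1 - w l)) * (t l : ℂ))


/-- The generating function of the Laguerre functions. -/
def lagGen (t : ℝ) (w : ℂ) : ℂ :=
  (1 - w)⁻¹ * Complex.exp (-(1/2) * ((1 + w)/(1 - w)) * (t : ℂ))

lemma one_sub_ne_zero_of_norm_lt_one {w : ℂ} (hw : ‖w‖ < 1) : 1 - w ≠ 0 := by
  intro h
  rw [← sub_eq_zero.1 h] at hw
  simp at hw

lemma hasSum_lag0 (t : ℝ) {w : ℂ} (hw : ‖w‖ < 1) :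
    HasSum (fun j : ℕ => (lag0 j t : ℂ) * w ^ j)
      ((1 - w)⁻¹ * Complex.exp (-(t : ℂ) * (w / (1 - w)))) := by
  have hne := one_sub_ne_zero_of_norm_lt_one hw
  set G : ℕ × ℕ → ℂ := fun p =>
    ((-(t : ℂ)) ^ p.1 / (p.1.factorial : ℂ) * w ^ p.1) *
      (((p.2 + p.1).choose p.1 : ℂ) * w ^ p.2) with hG
  have inner (k : ℕ) : HasSum (fun n => G (k, n))
      ((1 - w)⁻¹ * ((-(t : ℂ) * (w / (1 - w))) ^ k / (k.factorial : ℂ))) := by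
    convert! (hasSum_choose_mul_geometric_of_norm_lt_one k hw).mul_left
      ((-(t : ℂ)) ^ k / (k.factorial : ℂ) * w ^ k) using 1
    rw [mul_pow, div_pow, pow_succ]
    field_simp
  have hw' : ‖(‖w‖ : ℝ)‖ < 1 := by simpa using hw
  have hwpos : 0 < 1 - ‖w‖ := by linarith
  have innerNorm (k : ℕ) : HasSum (fun n => ‖G (k, n)‖)
      ((1 - ‖w‖)⁻¹ * ((|t| * (‖w‖ / (1 - ‖w‖))) ^ k / (k.factorial : ℝ))) := by
    convert! (hasSum_choose_mul_geometric_of_norm_lt_one k hw').mul_left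
      (|t| ^ k / (k.factorial : ℝ) * ‖w‖ ^ k) using 1
    · ext n
      simp [hG]
    · rw [mul_pow, div_pow, pow_succ]
      field_simp
  have hsum : Summable G := by
    refine Summable.of_norm ?_
    rw [summable_prod_of_nonneg (fun _ => norm_nonneg _)]
    refine ⟨fun k => (innerNorm k).summable, ?_⟩
    simp_rw [(innerNorm _).tsum_eq]
    exact (Real.summable_pow_div_factorial _).mul_left _
  have hexp : HasSum (fun k : ℕ => (1 - w)⁻¹ * ((-(t : ℂ) * (w / (1 - w))) ^ k / (k.factorial : ℂ)))
      ((1 - w)⁻¹ * Complex.exp (-(t : ℂ) * (w / (1 - w)))) := by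
    rw [Complex.exp_eq_exp_ℂ]
    exact HasSum.mul_left _ (NormedSpace.expSeries_div_hasSum_exp (-(t : ℂ) * (w / (1 - w))))
  have hS := hsum.hasSum
  rw [(hS.prod_fiberwise inner).unique hexp] at hS
  rw [← Finset.HasAntidiagonal.sigmaAntidiagonalEquivProd.hasSum_iff] at hS
  have := hS.sigma (fun j => hasSum_fintype _)
  convert! this using 1
  ext j
  change _ = ∑ b ∈ (antidiagonal j).attach, G b
  rw [Finset.sum_attach (antidiagonal j) G, Finset.Nat.sum_antidiagonal_eq_sum_range_succ_mk, lag0]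
  push_cast
  rw [Finset.sum_mul]
  refine Finset.sum_congr rfl fun k hk => ?_
  have hkj : k ≤ j := Nat.lt_succ_iff.1 (Finset.mem_range.1 hk)
  simp only [hG, Nat.sub_add_cancel hkj, Nat.cast_choose ℂ hkj]
  rw [show w ^ j = w ^ k * w ^ (j - k) by rw [← pow_add, Nat.add_sub_cancel' hkj]]
  field_simp

lemma hasSum_lagFun0 (t : ℝ) {w : ℂ} (hw : ‖w‖ < 1) :
    HasSum (fun j : ℕ => (lagFun0 j t : ℂ) * w ^ j) (lagGen t w) := by
  have hne := one_sub_ne_zero_of_norm_lt_one hw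
  convert! (hasSum_lag0 t hw).mul_left (Complex.exp (-(t : ℂ)/2)) using 1
  · ext j
    simp only [lagFun0]
    push_cast
    ring
  · rw [lagGen, mul_left_comm, ← Complex.exp_add]
    congr 2
    field_simp
    ring

lemma re_cayley {w : ℂ} (hw : ‖w‖ < 1) : 0 < ((1 + w) / (1 - w)).re := by
  have hne := one_sub_ne_zero_of_norm_lt_one hw
  have h1 : 0 < Complex.normSq (1 - w) := Complex.normSq_pos.2 hne
  have h2 : Complex.normSq w < 1 := by
    rw [Complex.normSq_eq_norm_sq]
    nlinarith [norm_nonneg w]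
  rw [Complex.div_re, ← add_div]
  refine div_pos ?_ h1
  rw [Complex.normSq_apply] at h2
  simp
  nlinarith

lemma norm_exp_cayley_le {t : ℝ} (ht : 0 ≤ t) {w : ℂ} (hw : ‖w‖ < 1) :
    ‖Complex.exp (-(1/2) * ((1 + w)/(1 - w)) * (t : ℂ))‖ ≤ 1 := by
  rw [Complex.norm_exp, Real.exp_le_one_iff]
  have h := re_cayley hw
  have e : (-(1/2) * ((1 + w)/(1 - w)) * (t : ℂ)).re = -(1/2) * ((1 + w)/(1 - w)).re * t := by
    rw [Complex.re_mul_ofReal, show (-(1/2) : ℂ) = ((-(1/2) : ℝ) : ℂ) by push_cast; rfl,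
      Complex.re_ofReal_mul]
  rw [e]
  have := mul_nonneg h.le ht
  linarith

lemma norm_coeff_le_of_hasSum {c : ℕ → ℂ} {g : ℂ → ℂ} {R C : ℝ} (hR : 0 < R)
    (hg : DiffContOnCl ℂ g (Metric.ball 0 R)) (hC : ∀ z ∈ Metric.sphere (0 : ℂ) R, ‖g z‖ ≤ C)
    (h : ∀ z ∈ Metric.ball (0 : ℂ) R, HasSum (fun n => c n * z ^ n) (g z)) (n : ℕ) :
    ‖c n‖ ≤ C / R ^ n := by
  have h1 : HasFPowerSeriesAt g (FormalMultilinearSeries.ofScalars ℂ c) 0 := by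
    rw [hasFPowerSeriesAt_iff]
    filter_upwards [Metric.ball_mem_nhds (0 : ℂ) hR] with z hz
    simpa [mul_comm] using h z hz
  have h2 : AnalyticAt ℂ g 0 := h1.analyticAt
  have h3 := h1.eq_formalMultilinearSeries h2.hasFPowerSeriesAt
  have h4 := FormalMultilinearSeries.ofScalars_series_injective ℂ ℂ h3
  have h5 := Complex.norm_iteratedDeriv_le_of_forall_mem_sphere_norm_le n hR hg hC
  rw [h4, norm_div, Complex.norm_natCast, div_le_iff₀ (by positivity)]
  calc _ ≤ _ := h5
    _ = _ := by ring

lemma abs_lagFun0_le {t : ℝ} (ht : 0 ≤ t) {r : ℝ} (hr : 0 < r) (hr1 : r < 1) (j : ℕ) :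
    |lagFun0 j t| ≤ (1 - r)⁻¹ / r ^ j := by
  have key := norm_coeff_le_of_hasSum (c := fun j => (lagFun0 j t : ℂ)) (g := lagGen t)
    (C := (1 - r)⁻¹) hr ?_ ?_ ?_ j
  · simpa using key
  · refine DifferentiableOn.diffContOnCl ?_
    intro w hw
    rw [closure_ball _ hr.ne', mem_closedBall_zero_iff] at hw
    have hne := one_sub_ne_zero_of_norm_lt_one (hw.trans_lt hr1)
    unfold lagGen
    refine DifferentiableAt.differentiableWithinAt ?_
    fun_prop (disch := assumption)
  · intro w hw
    rw [mem_sphere_zero_iff_norm] at hw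
    rw [lagGen, norm_mul, norm_inv]
    have h1 : 1 - r ≤ ‖1 - w‖ := by
      have := norm_sub_norm_le (1 : ℂ) w
      rw [norm_one, hw] at this
      exact this
    have h2 := norm_exp_cayley_le ht (hw.trans_lt hr1)
    calc _ ≤ ‖1 - w‖⁻¹ * 1 := by gcongr
      _ ≤ _ := by rw [mul_one]; exact inv_anti₀ (by linarith) h1
  · intro w hw
    rw [mem_ball_zero_iff] at hw
    exact hasSum_lagFun0 t (hw.trans hr1)

lemma continuous_lagFun0 (j : ℕ) : Continuous (lagFun0 j) := by
  unfold lagFun0 lag0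
  fun_prop

lemma HasSum.pi_prod {𝕜 : Type*} [NormedField 𝕜] [CompleteSpace 𝕜] {d : ℕ} {u : Fin d → ℕ → 𝕜}
    {s : Fin d → 𝕜} (hu : ∀ l, Summable fun j => ‖u l j‖) (hs : ∀ l, HasSum (u l) (s l)) :
    (Summable fun n : Fin d → ℕ => ‖∏ l, u l (n l)‖) ∧
      HasSum (fun n : Fin d → ℕ => ∏ l, u l (n l)) (∏ l, s l) := by
  induction d with
  | zero =>
    refine ⟨(hasSum_unique _).summable, ?_⟩
    simp only [Finset.univ_eq_empty, Finset.prod_empty]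
    exact hasSum_unique (fun _ : Fin 0 → ℕ => (1 : 𝕜))
  | succ d ih =>
    obtain ⟨h1, h2⟩ := ih (fun l => hu l.succ) (fun l => hs l.succ)
    rw [← (Fin.consEquiv fun _ => ℕ).summable_iff, ← (Fin.consEquiv fun _ => ℕ).hasSum_iff,
      Fin.prod_univ_succ]
    have e : (fun n : Fin (d+1) → ℕ => ∏ l, u l (n l)) ∘ (Fin.consEquiv fun _ => ℕ) =
        fun x => u 0 x.1 * ∏ l, u (Fin.succ l) (x.2 l) := by
      ext x
      simp [Fin.consEquiv, Fin.prod_univ_succ]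
    have h3 := Summable.mul_norm (hu 0) h1
    constructor
    · convert! h3 using 2 with x
      exact congrArg norm (congrFun e x)
    · rw [e]
      have h4 : Summable fun x : ℕ × (Fin d → ℕ) => u 0 x.1 * ∏ l, u (Fin.succ l) (x.2 l) :=
        h3.of_norm
      have h5 := HasSum.mul (f := u 0) (g := fun x : Fin d → ℕ => ∏ l, u (Fin.succ l) (x l)) (hs 0)
        h2
      exact h5 h4

lemma mderiv_zero {d : ℕ} (f : (Fin d → ℝ) → ℂ) : mderiv 0 f = f := by
  have h (l : List (((Fin d → ℝ) → ℂ) → ((Fin d → ℝ) → ℂ))) (hl : ∀ g ∈ l, g = id) :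
      l.foldr (· ∘ ·) id = id := by
    induction l with
    | nil => rfl
    | cons a l ih =>
      rw [List.foldr_cons, ih fun g hg => hl g (List.mem_cons_of_mem _ hg),
        hl a List.mem_cons_self, Function.comp_id]
  rw [mderiv, h]
  · rfl
  · intro g hg
    obtain ⟨i, rfl⟩ := (List.mem_ofFn' _ _).1 hg
    rfl

lemma isOpen_Rpos (d : ℕ) : IsOpen (Rpos d) := by
  rw [Rpos, Set.ofPred_forall]
  exact isOpen_iInter_of_finite fun i => isOpen_lt continuous_const (continuous_apply i)

lemma IsSPlus.continuousOn {d : ℕ} {f : (Fin d → ℝ) → ℂ} (hf : IsSPlus f) :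
    ContinuousOn f (Rpos d) :=
  hf.1.continuousOn

lemma IsSPlus.aestronglyMeasurable {d : ℕ} {f : (Fin d → ℝ) → ℂ} (hf : IsSPlus f) :
    AEStronglyMeasurable f (volume.restrict (Rpos d)) :=
  hf.continuousOn.aestronglyMeasurable (isOpen_Rpos d).measurableSet

lemma IsSPlus.integrable_mul_monomial {d : ℕ} {f : (Fin d → ℝ) → ℂ} (hf : IsSPlus f)
    (k : Fin d → ℕ) :
    Integrable (fun t => ((∏ i, t i ^ k i : ℝ) : ℂ) * f t) (volume.restrict (Rpos d)) := by
  choose C hC using fun k => hf.2.2 k 0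
  simp only [mderiv_zero] at hC
  have hint : Integrable (fun t : Fin d → ℝ => ∏ i, (1 + t i ^ 2)⁻¹) volume :=
    Integrable.fintype_prod (f := fun _ : Fin d => fun x : ℝ => (1 + x ^ 2)⁻¹)
      fun _ => integrable_inv_one_add_sq
  refine Integrable.mono'
    ((hint.const_mul
      (∑ s ∈ (univ : Finset (Fin d)).powerset, C fun i => k i + if i ∈ s then 2 else 0)).mono_measure
      Measure.restrict_le_self) ?_ ?_
  · exact (Continuous.aestronglyMeasurable (by fun_prop)).mul hf.aestronglyMeasurable
  · refine (ae_restrict_iff' (isOpen_Rpos d).measurableSet).2 (Eventually.of_forall fun t ht => ?_)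
    have hpos : 0 < ∏ i, (1 + t i ^ 2) := Finset.prod_pos fun i _ => by positivity
    have hmon : 0 ≤ ∏ i, t i ^ k i := Finset.prod_nonneg fun i _ => pow_nonneg (ht i).le _
    rw [norm_mul, Complex.norm_real, Real.norm_of_nonneg hmon, Finset.prod_inv_distrib,
      ← div_eq_mul_inv, le_div_iff₀ hpos, Finset.prod_one_add, Finset.mul_sum]
    refine Finset.sum_le_sum fun s _ => ?_
    refine le_trans (le_of_eq ?_) (hC _ t ht)
    have e : ∏ i ∈ s, t i ^ 2 = ∏ i, t i ^ (if i ∈ s then 2 else 0) := by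
      simp [pow_ite, Finset.prod_ite_mem]
    rw [e, mul_right_comm, ← Finset.prod_mul_distrib]
    simp_rw [pow_add]

lemma IsSPlus.integrable {d : ℕ} {f : (Fin d → ℝ) → ℂ} (hf : IsSPlus f) :
    Integrable f (volume.restrict (Rpos d)) := by
  simpa using hf.integrable_mul_monomial 0

lemma IsSPlus.integrable_coord_mul_norm {d : ℕ} {f : (Fin d → ℝ) → ℂ} (hf : IsSPlus f)
    (l : Fin d) : Integrable (fun t => |t l| * ‖f t‖) (volume.restrict (Rpos d)) := by
  have h := (hf.integrable_mul_monomial (Pi.single l 1)).norm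
  refine h.congr (Eventually.of_forall fun t => ?_)
  have e : ∏ i, t i ^ (Pi.single l 1 : Fin d → ℕ) i = t l := by
    rw [Finset.prod_eq_single l] <;> simp +contextual
  simp only [e, norm_mul, Complex.norm_real, Real.norm_eq_abs]

lemma exists_lt_one_of_mem_Dpoly {d : ℕ} {w : Fin d → ℂ} (hw : w ∈ Dpoly d) :
    ∃ r : ℝ, 0 < r ∧ r < 1 ∧ ‖w‖ < r := by
  have h : ‖w‖ < 1 := (pi_norm_lt_iff one_pos).2 hw
  exact ⟨(1 + ‖w‖) / 2, by positivity, by linarith, by linarith⟩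

/-- The kernel of the transform `FD`. -/
def FDker {d : ℕ} (w : Fin d → ℂ) (t : Fin d → ℝ) : ℂ :=
  ∏ l, Complex.exp (-(1/2) * ((1 + w l)/(1 - w l)) * (t l : ℂ))

lemma continuous_FDker {d : ℕ} (w : Fin d → ℂ) : Continuous (FDker w) := by
  unfold FDker
  fun_prop

lemma norm_FDker_le_one {d : ℕ} {w : Fin d → ℂ} (hw : w ∈ Dpoly d) {t : Fin d → ℝ}
    (ht : t ∈ Rpos d) : ‖FDker w t‖ ≤ 1 := by
  rw [FDker, norm_prod]
  exact Finset.prod_le_one (fun _ _ => norm_nonneg _)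
    fun l _ => norm_exp_cayley_le (ht l).le (hw l)

/-- The derivative of the kernel of `FD` with respect to `w`. -/
def FDkerDeriv {d : ℕ} (w : Fin d → ℂ) (t : Fin d → ℝ) : (Fin d → ℂ) →L[ℂ] ℂ :=
  FDker w t • ∑ l, (-(t l : ℂ) / (1 - w l) ^ 2) • ContinuousLinearMap.proj (R := ℂ) l

lemma continuous_FDkerDeriv {d : ℕ} (w : Fin d → ℂ) : Continuous (FDkerDeriv w) := by
  unfold FDkerDeriv
  refine (continuous_FDker w).smul (continuous_finsetSum _ fun l _ => ?_)
  have hc : Continuous fun t : Fin d → ℝ => -(t l : ℂ) / (1 - w l) ^ 2 := by fun_prop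
  exact hc.smul continuous_const

lemma hasFDerivAt_FDker {d : ℕ} {w : Fin d → ℂ} (hw : w ∈ Dpoly d) (t : Fin d → ℝ) :
    HasFDerivAt (fun w => FDker w t) (FDkerDeriv w t) w := by
  have h1 (l : Fin d) : HasFDerivAt
      (fun w : Fin d → ℂ => -(1/2) * ((1 + w l)/(1 - w l)) * (t l : ℂ))
      ((-(t l : ℂ) / (1 - w l) ^ 2) • ContinuousLinearMap.proj (R := ℂ) l) w := by
    have hne := one_sub_ne_zero_of_norm_lt_one (hw l)
    have h2 : HasDerivAt (fun z : ℂ => -(1/2) * ((1 + z)/(1 - z)) * (t l : ℂ))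
        (-(t l : ℂ) / (1 - w l) ^ 2) (w l) := by
      have h3 := ((((hasDerivAt_id (w l)).const_add 1).div ((hasDerivAt_id (w l)).const_sub 1)
        hne).const_mul (-(1/2) : ℂ)).mul_const (t l : ℂ)
      convert! h3 using 1
      simp only [id]
      field_simp
      ring
    exact h2.comp_hasFDerivAt w
      (ContinuousLinearMap.proj (R := ℂ) (φ := fun _ : Fin d => ℂ) l).hasFDerivAt
  have h4 := (HasFDerivAt.fun_sum (u := univ) fun l _ => h1 l).cexp
  simp only [Complex.exp_sum] at h4
  exact h4

lemma IsSPlus.differentiableOn_FD {d : ℕ} {f : (Fin d → ℝ) → ℂ} (hf : IsSPlus f) :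
    DifferentiableOn ℂ (FD f) (Dpoly d) := by
  intro w₀ hw₀
  obtain ⟨r, hr, hr1, hwr⟩ := exists_lt_one_of_mem_Dpoly hw₀
  have hball {w : Fin d → ℂ} (hw : w ∈ Metric.ball (0 : Fin d → ℂ) r) (l : Fin d) : ‖w l‖ < r :=
    (norm_le_pi_norm w l).trans_lt (mem_ball_zero_iff.1 hw)
  have hsub {w : Fin d → ℂ} (hw : w ∈ Metric.ball (0 : Fin d → ℂ) r) : w ∈ Dpoly d :=
    fun l => (hball hw l).trans hr1
  refine (HasFDerivAt.differentiableAt (𝕜 := ℂ) (f' := ∫ t in Rpos d, f t • FDkerDeriv w₀ t)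
    ?_).differentiableWithinAt
  refine hasFDerivAt_integral_of_dominated_of_fderiv_le (s := Metric.ball 0 r)
    (F := fun w t => f t * FDker w t) (F' := fun w t => f t • FDkerDeriv w t)
    (bound := fun t => ∑ l, ((1 - r) ^ 2)⁻¹ * (|t l| * ‖f t‖))
    (Metric.isOpen_ball.mem_nhds (mem_ball_zero_iff.2 hwr)) ?_ ?_ ?_ ?_ ?_ ?_
  · exact Eventually.of_forall fun w =>
      hf.aestronglyMeasurable.mul (continuous_FDker w).aestronglyMeasurable
  · refine hf.integrable.mul_bdd (c := 1) (continuous_FDker w₀).aestronglyMeasurable ?_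
    exact (ae_restrict_iff' (isOpen_Rpos d).measurableSet).2
      (Eventually.of_forall fun t ht => norm_FDker_le_one hw₀ ht)
  · exact hf.aestronglyMeasurable.smul (continuous_FDkerDeriv w₀).aestronglyMeasurable
  · refine (ae_restrict_iff' (isOpen_Rpos d).measurableSet).2
      (Eventually.of_forall fun t ht w hw => ?_)
    rw [FDkerDeriv, norm_smul, norm_smul, ← Finset.mul_sum, ← Finset.sum_mul, mul_comm ‖f t‖,
      ← mul_assoc]
    refine mul_le_mul_of_nonneg_right ?_ (norm_nonneg _)
    calc _ ≤ 1 * ∑ l, ((1 - r) ^ 2)⁻¹ * |t l| := by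
          refine mul_le_mul (norm_FDker_le_one (hsub hw) ht) ?_ (norm_nonneg _) zero_le_one
          refine (norm_sum_le _ _).trans (Finset.sum_le_sum fun l _ => ?_)
          have h1 : ‖ContinuousLinearMap.proj (R := ℂ) (φ := fun _ : Fin d => ℂ) l‖ ≤ 1 :=
            ContinuousLinearMap.opNorm_le_bound _ zero_le_one fun v => by
              simpa using norm_le_pi_norm v l
          have h2 : 1 - r ≤ ‖1 - w l‖ := by
            have := norm_sub_norm_le (1 : ℂ) (w l)
            rw [norm_one] at this
            linarith [hball hw l]
          have h3 : 0 < 1 - r := by linarith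
          rw [norm_smul, norm_div, norm_neg, Complex.norm_real, norm_pow, Real.norm_eq_abs]
          calc _ ≤ |t l| / ‖1 - w l‖ ^ 2 * 1 := by gcongr
            _ = (‖1 - w l‖ ^ 2)⁻¹ * |t l| := by ring
            _ ≤ _ := by gcongr
      _ = _ := by rw [one_mul, Finset.mul_sum]
  · exact integrable_finsetSum _ fun l _ => (hf.integrable_coord_mul_norm l).const_mul _
  · refine Eventually.of_forall fun t w hw => ?_
    exact (hasFDerivAt_FDker (hsub hw) t).const_mul (f t)

lemma continuous_LagFun0 {d : ℕ} (n : Fin d → ℕ) : Continuous (LagFun0 n) := by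
  unfold LagFun0
  exact continuous_finsetProd _ fun l _ => (continuous_lagFun0 (n l)).comp (continuous_apply l)

lemma hasSum_LagFun0 {d : ℕ} {w : Fin d → ℂ} (hw : w ∈ Dpoly d) (t : Fin d → ℝ) :
    HasSum (fun n : Fin d → ℕ => (LagFun0 n t : ℂ) * ∏ l, w l ^ n l)
      ((∏ l, (1 - w l))⁻¹ * FDker w t) := by
  have hnorm (l : Fin d) : Summable fun j : ℕ => ‖(lagFun0 j (t l) : ℂ) * w l ^ j‖ :=
    (hasSum_lagFun0 (t l) (hw l)).summable.norm
  have h := (HasSum.pi_prod hnorm fun l => hasSum_lagFun0 (t l) (hw l)).2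
  simpa only [LagFun0, FDker, lagGen, Complex.ofReal_prod, Finset.prod_mul_distrib,
    Finset.prod_inv_distrib] using h

lemma norm_LagFun0_mul_le {d : ℕ} {r : ℝ} (hr : 0 < r) (hr1 : r < 1) (w : Fin d → ℂ)
    {t : Fin d → ℝ} (ht : t ∈ Rpos d) (n : Fin d → ℕ) :
    ‖(LagFun0 n t : ℂ) * ∏ l, w l ^ n l‖ ≤ ∏ l, ((1 - r)⁻¹ * (‖w l‖ / r) ^ n l) := by
  rw [LagFun0, Complex.ofReal_prod, ← Finset.prod_mul_distrib, norm_prod]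
  refine Finset.prod_le_prod (fun _ _ => norm_nonneg _) fun l _ => ?_
  rw [norm_mul, Complex.norm_real, Real.norm_eq_abs, norm_pow]
  calc _ ≤ (1 - r)⁻¹ / r ^ n l * ‖w l‖ ^ n l := by
        gcongr
        exact abs_lagFun0_le (ht l).le hr hr1 _
    _ = _ := by rw [div_pow]; ring

lemma summable_LagFun0_bound {d : ℕ} {r : ℝ} (hr : 0 < r) {w : Fin d → ℂ} (hwr : ‖w‖ < r) :
    Summable fun n : Fin d → ℕ => ∏ l, ((1 - r)⁻¹ * (‖w l‖ / r) ^ n l) := by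
  have h (l : Fin d) : Summable fun j : ℕ => (1 - r)⁻¹ * (‖w l‖ / r) ^ j := by
    refine (summable_geometric_of_lt_one (by positivity) ?_).mul_left _
    exact (div_lt_one hr).2 ((norm_le_pi_norm w l).trans_lt hwr)
  exact (HasSum.pi_prod (fun l => (h l).norm) fun l => (h l).hasSum).1.of_norm

lemma IsSPlus.hasSum_coeff {d : ℕ} {f : (Fin d → ℝ) → ℂ} (hf : IsSPlus f)
    {w : Fin d → ℂ} (hw : w ∈ Dpoly d) :
    (Summable fun n : Fin d → ℕ =>
      ‖(∫ t in Rpos d, f t * (LagFun0 n t : ℂ)) * ∏ l, w l ^ n l‖) ∧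
    HasSum (fun n : Fin d → ℕ => (∫ t in Rpos d, f t * (LagFun0 n t : ℂ)) * ∏ l, w l ^ n l)
      ((∏ l, (1 - w l))⁻¹ * FD f w) := by
  obtain ⟨r, hr, hr1, hwr⟩ := exists_lt_one_of_mem_Dpoly hw
  set B : (Fin d → ℕ) → ℝ := fun n => ∏ l, ((1 - r)⁻¹ * (‖w l‖ / r) ^ n l) with hB
  have hbound (n : Fin d → ℕ) : ∀ᵐ t ∂(volume.restrict (Rpos d)),
      ‖(LagFun0 n t : ℂ) * ∏ l, w l ^ n l‖ ≤ B n :=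
    (ae_restrict_iff' (isOpen_Rpos d).measurableSet).2
      (Eventually.of_forall fun t ht => norm_LagFun0_mul_le hr hr1 w ht n)
  set F : (Fin d → ℕ) → (Fin d → ℝ) → ℂ := fun n t =>
    f t * ((LagFun0 n t : ℂ) * ∏ l, w l ^ n l) with hF
  have hFint (n : Fin d → ℕ) : Integrable (F n) (volume.restrict (Rpos d)) := by
    refine hf.integrable.mul_bdd (c := B n) (Continuous.aestronglyMeasurable ?_) (hbound n)
    have := continuous_LagFun0 n
    fun_prop
  have hFle (n : Fin d → ℕ) :
      ∫ t in Rpos d, ‖F n t‖ ≤ (∫ t in Rpos d, ‖f t‖) * B n := by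
    rw [← integral_mul_const]
    refine integral_mono_ae (hFint n).norm (hf.integrable.norm.mul_const _) ?_
    filter_upwards [hbound n] with t ht
    simp only [hF]
    rw [norm_mul]
    gcongr
  have hsum : Summable fun n => ∫ t in Rpos d, ‖F n t‖ :=
    Summable.of_nonneg_of_le (fun n => integral_nonneg fun _ => norm_nonneg _) hFle
      ((summable_LagFun0_bound hr hwr).mul_left _)
  have hcoeff (n : Fin d → ℕ) :
      ∫ t in Rpos d, F n t = (∫ t in Rpos d, f t * (LagFun0 n t : ℂ)) * ∏ l, w l ^ n l := by
    simp only [hF, ← mul_assoc]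
    exact integral_mul_const _ _
  have htsum : ∫ t in Rpos d, ∑' n, F n t = (∏ l, (1 - w l))⁻¹ * FD f w := by
    rw [FD, ← integral_const_mul]
    congr 1
    ext t
    rw [((hasSum_LagFun0 hw t).mul_left (f t)).tsum_eq, FDker]
    ring
  have h := hasSum_integral_of_summable_integral_norm hFint hsum
  rw [htsum] at h
  simp only [hcoeff] at h
  refine ⟨Summable.of_nonneg_of_le (fun _ => norm_nonneg _) (fun n => ?_) hsum, h⟩
  rw [← hcoeff]
  exact norm_integral_le_integral_norm _

lemma exists_cayley_eq_one_add_mul_I (y : ℝ) :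
    ∃ w : ℂ, ‖w‖ < 1 ∧ (1 + w) / (1 - w) = 1 + y * Complex.I := by
  set s : ℂ := 1 + y * Complex.I with hs
  have hre : (s + 1).re = 2 := by simp [hs]; norm_num
  have hne : s + 1 ≠ 0 := fun h => by simp [h] at hre
  refine ⟨(s - 1) / (s + 1), ?_, ?_⟩
  · rw [norm_div, div_lt_one (norm_pos_iff.2 hne), ← sq_lt_sq₀ (norm_nonneg _) (norm_nonneg _),
      ← Complex.normSq_eq_norm_sq, ← Complex.normSq_eq_norm_sq, Complex.normSq_apply,
      Complex.normSq_apply]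
    simp [hs]
  · have h2 : 1 - (s - 1) / (s + 1) = 2 / (s + 1) := by field_simp; ring
    rw [h2]
    field_simp
    ring

open scoped FourierTransform in
lemma IsSPlus.eq_zero_of_FD_eq_zero {d : ℕ} {f : (Fin d → ℝ) → ℂ} (hf : IsSPlus f)
    (h : ∀ w ∈ Dpoly d, FD f w = 0) : ∀ t ∈ Rpos d, f t = 0 := by
  intro t ht
  set E : (Fin d → ℝ) → ℂ := fun t => Complex.exp (∑ l, -(1/2) * (t l : ℂ)) with hE
  have hEc : Continuous E := by fun_prop
  set g₀ : (Fin d → ℝ) → ℂ := (Rpos d).indicator fun t => f t * E t with hg₀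
  set g : EuclideanSpace ℝ (Fin d) → ℂ := fun v => g₀ (WithLp.ofLp v) with hg
  have hmp := PiLp.volume_preserving_ofLp (Fin d)
  have hemb : MeasurableEmbedding (WithLp.ofLp : EuclideanSpace ℝ (Fin d) → (Fin d → ℝ)) :=
    (MeasurableEquiv.toLp 2 (Fin d → ℝ)).symm.measurableEmbedding
  have hg₀int : Integrable g₀ volume := by
    rw [hg₀, integrable_indicator_iff (isOpen_Rpos d).measurableSet]
    refine hf.integrable.mul_bdd (c := 1) hEc.aestronglyMeasurable ?_
    refine (ae_restrict_iff' (isOpen_Rpos d).measurableSet).2 (Eventually.of_forall fun t ht => ?_)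
    rw [hE, Complex.norm_exp, Real.exp_le_one_iff, Complex.re_sum]
    refine Finset.sum_nonpos fun l _ => ?_
    have := ht l
    simp
    linarith
  have hgint : Integrable g volume := (hmp.integrable_comp_emb hemb).2 hg₀int
  have hfour : 𝓕 g = 0 := by
    ext ξ
    choose w hw1 hw2 using fun l => exists_cayley_eq_one_add_mul_I (4 * Real.pi * ξ l)
    rw [Real.fourier_eq']
    have h1 := hmp.integral_comp hemb (fun t : Fin d → ℝ =>
      Complex.exp (((-2 * Real.pi * ∑ l, ξ l * t l : ℝ) : ℂ) * Complex.I) • g₀ t)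
    have h2 : ∀ v : EuclideanSpace ℝ (Fin d), inner ℝ v ξ = ∑ l, ξ l * v l := fun v => by
      simp [PiLp.inner_apply]
    simp only [h2]
    refine h1.trans ?_
    rw [Pi.zero_apply, ← h w hw1, FD, ← integral_indicator (isOpen_Rpos d).measurableSet]
    congr 1
    ext t
    by_cases ht : t ∈ Rpos d
    · simp only [hg₀, Set.indicator_of_mem ht, hw2, hE, ← Complex.exp_sum, smul_eq_mul]
      rw [mul_left_comm, ← Complex.exp_add]
      congr 2
      push_cast
      rw [Finset.mul_sum, Finset.sum_mul, ← Finset.sum_add_distrib]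
      refine Finset.sum_congr rfl fun l _ => ?_
      ring
    · simp only [hg₀, Set.indicator_of_notMem ht, smul_zero]
  have hcont : ContinuousAt g (WithLp.toLp 2 t) := by
    have hc₀ : ContinuousAt g₀ t := by
      refine ContinuousAt.congr (f := fun t => f t * E t) ?_ ?_
      · exact (hf.continuousOn.continuousAt ((isOpen_Rpos d).mem_nhds ht)).mul hEc.continuousAt
      · filter_upwards [(isOpen_Rpos d).mem_nhds ht] with x hx
        rw [hg₀, Set.indicator_of_mem hx]
    exact ContinuousAt.comp (f := WithLp.ofLp) hc₀ (PiLp.continuous_ofLp 2 _).continuousAt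
  have hinv := hgint.fourierInv_fourier_eq (by rw [hfour]; exact integrable_zero _ _ _) hcont
  rw [hfour, Real.fourierInv_eq] at hinv
  simp only [Pi.zero_apply, smul_zero, integral_zero, hg, hg₀, Set.indicator_of_mem ht] at hinv
  exact (mul_eq_zero.1 hinv.symm).resolve_right (Complex.exp_ne_zero _)

/-- For `f ∈ S(ℝ^d₊)` with Fourier-Laguerre coefficients `a_n`, `ℱ_D(f)` is holomorphic on
the polydisc, `∑ a_n w^n` converges absolutely there, and
`ℱ_D(f)(w) = ∏(1−w_j) ∑ a_n w^n`; in particular `ℱ_D(f) = 0` implies `f = 0`. -/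
theorem stmt10 {d : ℕ} (f : (Fin d → ℝ) → ℂ) (hf : IsSPlus f)
    (a : (Fin d → ℕ) → ℂ)
    (ha : ∀ n : Fin d → ℕ, a n = ∫ t in Rpos d, f t * ((LagFun0 n t : ℝ) : ℂ)) :
    DifferentiableOn ℂ (FD f) (Dpoly d) ∧
    (∀ w ∈ Dpoly d, Summable (fun n : Fin d → ℕ => ‖a n * ∏ l, w l ^ n l‖)) ∧
    (∀ w ∈ Dpoly d,
      FD f w = (∏ j, (1 - w j)) * ∑' n : Fin d → ℕ, a n * ∏ l, w l ^ n l) ∧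
    ((∀ w ∈ Dpoly d, FD f w = 0) → ∀ t ∈ Rpos d, f t = 0) := by
  refine ⟨hf.differentiableOn_FD, fun w hw => ?_, fun w hw => ?_, hf.eq_zero_of_FD_eq_zero⟩
  · simp only [ha]
    exact (hf.hasSum_coeff hw).1
  · simp only [ha]
    rw [(hf.hasSum_coeff hw).2.tsum_eq, mul_inv_cancel_left₀]
    exact Finset.prod_ne_zero_iff.2 fun l _ => one_sub_ne_zero_of_norm_lt_one (hw l)
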